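/- The ℂ-algebra homomorphism ℂ[x,y,z,u] → ℂ[x₁,x₂,x₃,x₄] sending x ↦ x₁x₃, y ↦ x₁x₄, z ↦ x₂x₃, u ↦ x₂x₄ induces a ℂ-algebra isomorphism from the quotient ring ℂ[x,y,z,u]/(xu − yz) onto the subalgebra of ℂ*-invariant polynomials in ℂ[x₁,x₂,x₃,x₄] (invariance for the action t·(v₁,v₂,v₃,v₄) = (t⁻¹v₁, t⁻¹v₂, t v₃, t v₄)). -/

import Mathlib

open MvPolynomial

/-- The ℂ-algebra homomorphism ℂ[x,y,z,u] → ℂ[x₁,x₂,x₃,x₄] determined by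
x ↦ x₁x₃, y ↦ x₁x₄, z ↦ x₂x₃, u ↦ x₂x₄ (variables indexed by `Fin 4`). -/
noncomputable def conifoldHom : MvPolynomial (Fin 4) ℂ →ₐ[ℂ] MvPolynomial (Fin 4) ℂ :=
  aeval ![X 0 * X 2, X 0 * X 3, X 1 * X 2, X 1 * X 3]

/-- The action of t ∈ ℂ* on ℂ⁴ with weights (−1,−1,1,1):
t·(v₁,v₂,v₃,v₄) = (t⁻¹v₁, t⁻¹v₂, t v₃, t v₄). -/
noncomputable def torusAct (t : ℂ) (v : Fin 4 → ℂ) : Fin 4 → ℂ :=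
  ![t⁻¹ * v 0, t⁻¹ * v 1, t * v 2, t * v 3]

/-- The subalgebra of ℂ[x₁,x₂,x₃,x₄] consisting of the polynomials invariant under the
ℂ*-action with weights (−1,−1,1,1). -/
noncomputable def invariantSubalgebra : Subalgebra ℂ (MvPolynomial (Fin 4) ℂ) where
  carrier := {f : MvPolynomial (Fin 4) ℂ |
    ∀ t : ℂ, t ≠ 0 → ∀ v : Fin 4 → ℂ, eval (torusAct t v) f = eval v f}
  mul_mem' := by
    intro a b ha hb t ht v
    simp only [map_mul, ha t ht v, hb t ht v]
  add_mem' := by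
    intro a b ha hb t ht v
    simp only [map_add, ha t ht v, hb t ht v]
  algebraMap_mem' := by
    intro r t ht v
    simp [MvPolynomial.algebraMap_eq]

/-- The normal form of a monomial of `ℂ[x,y,z,u]` modulo `xu - yz` (no factor `yz`), written in terms
of the exponent `m` of its image in `ℂ[x₁,x₂,x₃,x₄]`. -/
noncomputable def conifoldNormalForm (m : Fin 4 →₀ ℕ) : MvPolynomial (Fin 4) ℂ :=
  X 0 ^ min (m 0) (m 2) * X 1 ^ (m 0 - m 2) * X 2 ^ (m 2 - m 0) * X 3 ^ (m 1 - (m 2 - m 0))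

/-- The linear extension of `conifoldNormalForm` to all polynomials. -/
noncomputable def conifoldSection : MvPolynomial (Fin 4) ℂ →ₗ[ℂ] MvPolynomial (Fin 4) ℂ :=
  (basisMonomials (Fin 4) ℂ).constr ℂ conifoldNormalForm

theorem conifoldSection_monomial (m : Fin 4 →₀ ℕ) (c : ℂ) :
    conifoldSection (monomial m c) = c • conifoldNormalForm m := by
  have h : (monomial m c : MvPolynomial (Fin 4) ℂ) = c • basisMonomials (Fin 4) ℂ m := by
    simp [smul_monomial]
  rw [h, map_smul, conifoldSection, Module.Basis.constr_basis]

theorem monomial_one_fin_four (m : Fin 4 →₀ ℕ) :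
    (monomial m 1 : MvPolynomial (Fin 4) ℂ) = X 0 ^ m 0 * X 1 ^ m 1 * X 2 ^ m 2 * X 3 ^ m 3 := by
  rw [monomial_eq, C_1, one_mul, Finsupp.prod_fintype _ _ (fun _ => pow_zero _),
    Fin.prod_univ_four]

theorem conifoldHom_monomial_one (m : Fin 4 →₀ ℕ) :
    ∃ n : Fin 4 →₀ ℕ, conifoldHom (monomial m 1) = monomial n 1 ∧
      n 0 = m 0 + m 1 ∧ n 1 = m 2 + m 3 ∧ n 2 = m 0 + m 2 ∧ n 3 = m 1 + m 3 := by
  refine ⟨Finsupp.equivFunOnFinite.symm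
    ![m 0 + m 1, m 2 + m 3, m 0 + m 2, m 1 + m 3], ?_, by simp, by simp, by simp, by simp⟩
  rw [monomial_one_fin_four, monomial_one_fin_four]
  simp [conifoldHom]
  ring

/-- In a commutative ring with `x u = y z`, a monomial equals its normal form. -/
theorem normalForm_eq_of_mul_eq {R : Type*} [CommRing R] {x y z u : R} (h : x * u = y * z)
    (p q r s : ℕ) :
    x ^ min (p + q) (p + r) * y ^ (p + q - (p + r)) * z ^ (p + r - (p + q)) *
      u ^ (r + s - (p + r - (p + q))) = x ^ p * y ^ q * z ^ r * u ^ s := by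
  rcases le_total q r with hqr | hqr
  · obtain ⟨k, rfl⟩ := Nat.exists_eq_add_of_le hqr
    have h1 : min (p + q) (p + (q + k)) = p + q := by omega
    have h2 : p + q - (p + (q + k)) = 0 := by omega
    have h3 : p + (q + k) - (p + q) = k := by omega
    have h4 : q + k + s - k = q + s := by omega
    rw [h1, h2, h3, h4]
    calc _ = (x * u) ^ q * (x ^ p * z ^ k * u ^ s) := by ring
      _ = _ := by rw [h]; ring
  · obtain ⟨k, rfl⟩ := Nat.exists_eq_add_of_le hqr
    have h1 : min (p + (r + k)) (p + r) = p + r := by omega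
    have h2 : p + (r + k) - (p + r) = k := by omega
    have h3 : p + r - (p + (r + k)) = 0 := by omega
    rw [h1, h2, h3, Nat.sub_zero]
    calc _ = (x * u) ^ r * (x ^ p * y ^ k * u ^ s) := by ring
      _ = _ := by rw [h]; ring

theorem mk_conifoldSection_conifoldHom (f : MvPolynomial (Fin 4) ℂ) :
    Ideal.Quotient.mk (Ideal.span {(X 0 * X 3 - X 1 * X 2 : MvPolynomial (Fin 4) ℂ)})
      (conifoldSection (conifoldHom f)) = Ideal.Quotient.mk _ f := by
  set I := Ideal.span {(X 0 * X 3 - X 1 * X 2 : MvPolynomial (Fin 4) ℂ)}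
  have hI : Ideal.Quotient.mk I (X 0) * Ideal.Quotient.mk I (X 3) =
      Ideal.Quotient.mk I (X 1) * Ideal.Quotient.mk I (X 2) := by
    rw [← map_mul, ← map_mul, Ideal.Quotient.eq]
    exact Ideal.subset_span rfl
  induction f using MvPolynomial.induction_on' with
  | monomial m a =>
    obtain ⟨n, hn, h0, h1, h2, -⟩ := conifoldHom_monomial_one m
    have hma : (monomial m a : MvPolynomial (Fin 4) ℂ) = a • monomial m 1 := by
      rw [smul_monomial, smul_eq_mul, mul_one]
    have key : Ideal.Quotient.mk I (conifoldNormalForm n) =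
        Ideal.Quotient.mk I (monomial m 1) := by
      rw [conifoldNormalForm, monomial_one_fin_four, h0, h1, h2]
      simp only [map_mul, map_pow]
      exact normalForm_eq_of_mul_eq hI _ _ _ _
    rw [hma, map_smul, hn, map_smul, conifoldSection_monomial, one_smul, smul_eq_C_mul,
      smul_eq_C_mul, map_mul, map_mul, key]
  | add p q hp hq => simp only [map_add, hp, hq]

theorem conifoldHom_normalForm {m : Fin 4 →₀ ℕ} (hm : m 0 + m 1 = m 2 + m 3) :
    conifoldHom (conifoldNormalForm m) = monomial m 1 := by
  have h0 : m 0 = min (m 0) (m 2) + (m 0 - m 2) := by omega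
  have h1 : m 1 = (m 2 - m 0) + (m 1 - (m 2 - m 0)) := by omega
  have h2 : m 2 = min (m 0) (m 2) + (m 2 - m 0) := by omega
  have h3 : m 3 = (m 0 - m 2) + (m 1 - (m 2 - m 0)) := by omega
  rw [monomial_one_fin_four, conifoldNormalForm]
  generalize min (m 0) (m 2) = p at *
  generalize m 0 - m 2 = q at *
  generalize m 2 - m 0 = r at *
  generalize m 1 - r = s at *
  rw [h0, h1, h2, h3]
  simp [conifoldHom]
  ring

theorem coeff_aeval_C_mul_X {σ R : Type*} [CommSemiring R] (c : σ → R) (f : MvPolynomial σ R)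
    (m : σ →₀ ℕ) :
    coeff m (aeval (fun i => C (c i) * X i : σ → MvPolynomial σ R) f) =
      m.prod (fun i k => c i ^ k) * coeff m f := by
  classical
  induction f using MvPolynomial.induction_on' with
  | monomial n a =>
    have h : aeval (fun i => C (c i) * X i : σ → MvPolynomial σ R) (monomial n a) =
        C (n.prod fun i k => c i ^ k) * monomial n a := by
      rw [aeval_monomial, monomial_eq, algebraMap_eq]
      simp only [mul_pow, Finsupp.prod, Finset.prod_mul_distrib, map_prod, map_pow]
      ring
    rw [h, coeff_C_mul, coeff_monomial]
    split_ifs with hnm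
    · rw [hnm]
    · simp
  | add p q hp hq => rw [map_add, coeff_add, hp, hq, coeff_add, mul_add]

theorem exponent_balanced_of_mem_invariantSubalgebra {f : MvPolynomial (Fin 4) ℂ}
    (hf : f ∈ invariantSubalgebra) {m : Fin 4 →₀ ℕ} (hm : m ∈ f.support) :
    m 0 + m 1 = m 2 + m 3 := by
  have hact : aeval (fun i => C ((![2⁻¹, 2⁻¹, 2, 2] : Fin 4 → ℂ) i) * X i :
      Fin 4 → MvPolynomial (Fin 4) ℂ) f = f := by
    apply MvPolynomial.funext
    intro v
    have hv : torusAct 2 v = fun i => (![2⁻¹, 2⁻¹, 2, 2] : Fin 4 → ℂ) i * v i := by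
      ext i
      fin_cases i <;> simp [torusAct]
    rw [← hf 2 two_ne_zero v, hv, ← coe_aeval_eq_eval, ← coe_aeval_eq_eval]
    simp only [RingHom.coe_coe]
    rw [comp_aeval_apply]
    simp
  have hc := coeff_aeval_C_mul_X (![2⁻¹, 2⁻¹, 2, 2] : Fin 4 → ℂ) f m
  rw [hact, eq_comm, mul_eq_right₀ (mem_support_iff.mp hm),
    Finsupp.prod_fintype _ _ (fun _ => pow_zero _), Fin.prod_univ_four] at hc
  simp only [Matrix.cons_val, inv_pow] at hc
  have h2 : (2 : ℂ) ^ (m 2 + m 3) = 2 ^ (m 0 + m 1) := by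
    have h0 : (2 : ℂ) ^ m 0 ≠ 0 := pow_ne_zero _ two_ne_zero
    have h1 : (2 : ℂ) ^ m 1 ≠ 0 := pow_ne_zero _ two_ne_zero
    field_simp at hc
    rw [pow_add, pow_add, hc]
  exact (Nat.pow_right_injective le_rfl (by exact_mod_cast h2)).symm

theorem conifoldHom_conifoldSection {f : MvPolynomial (Fin 4) ℂ} (hf : f ∈ invariantSubalgebra) :
    conifoldHom (conifoldSection f) = f := by
  conv_rhs => rw [f.as_sum]
  conv_lhs => rw [f.as_sum]
  rw [map_sum, map_sum]
  refine Finset.sum_congr rfl fun m hm => ?_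
  rw [conifoldSection_monomial, map_smul,
    conifoldHom_normalForm (exponent_balanced_of_mem_invariantSubalgebra hf hm), smul_monomial,
    smul_eq_mul, mul_one]

theorem conifoldHom_mem_invariantSubalgebra (f : MvPolynomial (Fin 4) ℂ) :
    conifoldHom f ∈ invariantSubalgebra := by
  intro t ht v
  induction f using MvPolynomial.induction_on with
  | C a => simp [conifoldHom, algebraMap_eq]
  | add p q hp hq => simp only [map_add, hp, hq]
  | mul_X p i hp =>
    rw [map_mul, map_mul, map_mul, hp]
    congr 1
    fin_cases i <;> simp [conifoldHom, torusAct] <;> field_simp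

/-- The homomorphism x ↦ x₁x₃, y ↦ x₁x₄, z ↦ x₂x₃, u ↦ x₂x₄ induces a ℂ-algebra
isomorphism ℂ[x,y,z,u]/(xu − yz) ≃ {ℂ*-invariant polynomials in ℂ[x₁,x₂,x₃,x₄]}. -/
theorem conifold_quotient_iso_invariants :
    ∃ e : (MvPolynomial (Fin 4) ℂ ⧸
        Ideal.span {(X 0 * X 3 - X 1 * X 2 : MvPolynomial (Fin 4) ℂ)}) ≃ₐ[ℂ]
        invariantSubalgebra,
      ∀ f : MvPolynomial (Fin 4) ℂ,
        (e (Ideal.Quotient.mk _ f) : MvPolynomial (Fin 4) ℂ) = conifoldHom f := by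
  let φ := conifoldHom.codRestrict invariantSubalgebra conifoldHom_mem_invariantSubalgebra
  have hφ : ∀ a ∈ Ideal.span {(X 0 * X 3 - X 1 * X 2 : MvPolynomial (Fin 4) ℂ)}, φ a = 0 := by
    suffices h : Ideal.span {(X 0 * X 3 - X 1 * X 2 : MvPolynomial (Fin 4) ℂ)} ≤
        RingHom.ker φ from fun a ha => h ha
    rw [Ideal.span_singleton_le_iff_mem, RingHom.mem_ker]
    apply Subtype.ext
    simp [φ, conifoldHom]
    ring
  have hlift : ∀ f, (Ideal.Quotient.liftₐ _ φ hφ (Ideal.Quotient.mk _ f) :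
      MvPolynomial (Fin 4) ℂ) = conifoldHom f := fun f => rfl
  refine ⟨AlgEquiv.ofBijective (Ideal.Quotient.liftₐ _ φ hφ) ⟨?_, ?_⟩, hlift⟩
  · intro a b hab
    obtain ⟨f, rfl⟩ := Ideal.Quotient.mk_surjective a
    obtain ⟨g, rfl⟩ := Ideal.Quotient.mk_surjective b
    have h : conifoldHom f = conifoldHom g := by rw [← hlift, ← hlift, hab]
    rw [← mk_conifoldSection_conifoldHom f, h, mk_conifoldSection_conifoldHom]
  · intro g
    exact ⟨Ideal.Quotient.mk _ (conifoldSection g),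
      Subtype.ext ((hlift _).trans (conifoldHom_conifoldSection g.2))⟩
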